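/- arXiv:2006.01732 — 2 statements merged into one kernel-verified Lean document; each statement's English description precedes it below -/
import Mathlib

section
/- Let C ≥ 1, let X be a type, K : X → X → ℝ a kernel with K(x, x') ≥ 0 for all x, x', 𝓛 a finite multiset of labeled pairs from X × Fin C, x_c ∈ X a candidate instance, 𝓤 a nonempty finite set of instances, and ε ≥ 0 a uniform prior scalar. For each y_c ∈ Fin C let 𝓛⁺(y_c) = 𝓛 + {(x_c, y_c)}. Assume Σ_y (k_{x_c}^𝓛(y) + ε) > 0, and that for every x ∈ 𝓤 and every y_c ∈ Fin C one has Σ_y (k_x^{𝓛⁺(y_c)}(y) + ε) > 0 and the vector k_x^{𝓛⁺(y_c)} has a unique maximizer, denoted f^{𝓛⁺(y_c)}(x). Then Σ_{y_c ∈ Fin C} ((k_{x_c}^𝓛(y_c) + ε)/Σ_i (k_{x_c}^𝓛(i) + ε)) · (1/|𝓤|) · Σ_{x ∈ 𝓤} (1 − max_{y} ((k_x^{𝓛⁺(y_c)}(y) + ε)/Σ_i (k_x^{𝓛⁺(y_c)}(i) + ε))) = Σ_{y_c ∈ Fin C} ((k_{x_c}^𝓛(y_c) + ε)/Σ_i (k_{x_c}^𝓛(i)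 + ε)) · (1/|𝓤|) · Σ_{x ∈ 𝓤} Σ_{y ∈ Fin C} ((k_x^{𝓛⁺(y_c)}(y) + ε)/Σ_i (k_x^{𝓛⁺(y_c)}(i) + ε)) · L(y, f^{𝓛⁺(y_c)}(x)). (Theorem 1: reformulation of the expected error reduction criterion of Roy & McCallum with Chapelle's prior.) -/
/-- Zero-one loss: `0` if the label equals the prediction, `1` otherwise. -/
noncomputable def zeroOneLoss {C : ℕ} (y yhat : Fin C) : ℝ :=
  if y = yhat then 0 else 1

/-- `yhat` is the unique maximizer of `v` iff every other class has strictly smaller value. -/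
def IsUniqueMax {C : ℕ} (v : Fin C → ℝ) (yhat : Fin C) : Prop :=
  ∀ y : Fin C, y ≠ yhat → v y < v yhat

/-- Kernel frequency vector: similarity-weighted label counts of class `y` at `x`. -/
noncomputable def kfreq {C : ℕ} {X : Type*} (K : X → X → ℝ)
    (𝓛 : Multiset (X × Fin C)) (x : X) (y : Fin C) : ℝ :=
  (𝓛.map (fun p => if p.2 = y then K x p.1 else 0)).sum

/-- **Theorem 1 (EER reformulation).** The expected error reduction criterion of
Roy & McCallum with Chapelle's uniform prior `ε` can be rewritten using the
zero-one loss of the updated classifier's prediction. -/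
theorem eer_reformulation {C : ℕ} (hC : 1 ≤ C) {X : Type*} (K : X → X → ℝ)
    (hK : ∀ x x' : X, 0 ≤ K x x')
    (𝓛 : Multiset (X × Fin C)) (xc : X)
    (𝓤 : Finset X) (h𝓤 : 𝓤.Nonempty)
    (ε : ℝ) (hε : 0 ≤ ε)
    (hden : 0 < ∑ y : Fin C, (kfreq K 𝓛 xc y + ε))
    (f : X → Fin C → Fin C)
    (hdenp : ∀ x ∈ 𝓤, ∀ yc : Fin C,
      0 < ∑ y : Fin C, (kfreq K (𝓛 + {(xc, yc)}) x y + ε))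
    (hf : ∀ x ∈ 𝓤, ∀ yc : Fin C,
      IsUniqueMax (kfreq K (𝓛 + {(xc, yc)}) x) (f x yc)) :
    ∑ yc : Fin C, ((kfreq K 𝓛 xc yc + ε) / ∑ i : Fin C, (kfreq K 𝓛 xc i + ε)) *
      ((1 / (𝓤.card : ℝ)) * ∑ x ∈ 𝓤,
        (1 - Finset.univ.sup' (Finset.univ_nonempty_iff.mpr ⟨⟨0, hC⟩⟩)
          (fun y => (kfreq K (𝓛 + {(xc, yc)}) x y + ε) /
            ∑ i : Fin C, (kfreq K (𝓛 + {(xc, yc)}) x i + ε))))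
    =
    ∑ yc : Fin C, ((kfreq K 𝓛 xc yc + ε) / ∑ i : Fin C, (kfreq K 𝓛 xc i + ε)) *
      ((1 / (𝓤.card : ℝ)) * ∑ x ∈ 𝓤, ∑ y : Fin C,
        ((kfreq K (𝓛 + {(xc, yc)}) x y + ε) /
          ∑ i : Fin C, (kfreq K (𝓛 + {(xc, yc)}) x i + ε)) *
          zeroOneLoss y (f x yc)) := by
  refine Finset.sum_congr rfl fun yc _ => ?_
  congr 2
  refine Finset.sum_congr rfl fun x hx => ?_
  have hS := hdenp x hx yc
  have hm := hf x hx yc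
  have hsup : Finset.univ.sup' (Finset.univ_nonempty_iff.mpr ⟨⟨0, hC⟩⟩)
          (fun y => (kfreq K (𝓛 + {(xc, yc)}) x y + ε) /
            ∑ i : Fin C, (kfreq K (𝓛 + {(xc, yc)}) x i + ε)) =
      (kfreq K (𝓛 + {(xc, yc)}) x (f x yc) + ε) /
            ∑ i : Fin C, (kfreq K (𝓛 + {(xc, yc)}) x i + ε) := by
    apply le_antisymm
    · refine Finset.sup'_le _ _ fun y _ => ?_
      refine div_le_div_of_nonneg_right ?_ hS.le
      by_cases h : y = f x yc
      · rw [h]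
      · linarith [hm y h]
    · exact Finset.le_sup' (fun y => (kfreq K (𝓛 + {(xc, yc)}) x y + ε) /
            ∑ i : Fin C, (kfreq K (𝓛 + {(xc, yc)}) x i + ε)) (Finset.mem_univ (f x yc))
  rw [hsup]
  have h1 : ∑ y : Fin C, (kfreq K (𝓛 + {(xc, yc)}) x y + ε) /
            ∑ i : Fin C, (kfreq K (𝓛 + {(xc, yc)}) x i + ε) = 1 := by
    rw [← Finset.sum_div, div_self hS.ne']
  have h2 : ∀ (p : Fin C → ℝ) (a : Fin C),
      ∑ y : Fin C, p y * zeroOneLoss y a = ∑ y : Fin C, p y - p a := by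
    intro p a
    have h3 : ∀ y, p y * zeroOneLoss y a = p y - if y = a then p y else 0 := by
      intro y
      unfold zeroOneLoss
      split_ifs <;> simp
    simp [h3, Finset.sum_sub_distrib]
  rw [h2 (fun y => (kfreq K (𝓛 + {(xc, yc)}) x y + ε) /
            ∑ i : Fin C, (kfreq K (𝓛 + {(xc, yc)}) x i + ε)), h1]
end

section
/- Let C ≥ 1 and let k : Fin C → ℝ satisfy k_y ≥ 0 for all y; set s = Σ_y (k_y + 1). Assume k has a unique maximizer ŷ, and for each y_c ∈ Fin C the vector k + e_{y_c} has a unique maximizer ŷ⁺(y_c). Then for every p̂ ∈ ℝ: p̂ · ( Σ_{y_c ∈ Fin C} ( (1/(s·(s+1))) · Π_{i ∈ Fin C} Π_{j=1}^{(e_{y_c})_i + (e_{ŷ⁺(y_c)})_i} (k_i + j) ) − (k_ŷ + 1)/s ) = − p̂ · Σ_{y_c ∈ Fin C} ((k_{y_c} + 1)/s) · Σ_{y ∈ Fin C} (((k + e_{y_c})_y + 1)/(s + 1)) · (L(y, ŷ⁺(y_c)) − L(y, ŷ)), where the inner product is over natural numbers j from 1 to (e_{y_c})_i + (e_{ŷ⁺(y_c)})_i.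 (Theorem 2: the multi-class probabilistic active learning criterion of Kottke et al. with m = 1 equals the density-weighted expected local gain in the xPAL form.) -/
/-- Natural-number standard basis vector: `(eN a) i = 1` if `i = a`, else `0`. -/
def eN {C : ℕ} (a i : Fin C) : ℕ := if i = a then 1 else 0

/-- Real-valued standard basis vector `e_a`. -/
noncomputable def eR {C : ℕ} (a i : Fin C) : ℝ := (eN a i : ℝ)

theorem pal_prod_aux {C : ℕ} (k : Fin C → ℝ) (a b : Fin C) :
    ∏ i : Fin C, ∏ j ∈ Finset.Icc 1 (eN a i + eN b i), (k i + (j : ℝ))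
      = (k a + 1) * (k b + eR a b + 1) := by
  have h : ∀ i : Fin C, ∏ j ∈ Finset.Icc 1 (eN a i + eN b i), (k i + (j : ℝ))
      = (if i = a then k i + 1 else 1) * (if i = b then k i + eR a i + 1 else 1) := by
    intro i
    unfold eR eN
    by_cases h1 : i = a <;> by_cases h2 : i = b
    · subst h1
      subst h2
      simp only [if_true]
      rw [Finset.prod_Icc_succ_top (by norm_num)]
      simp
      left
      ring
    · simp [h1, h2]
      simp [← h1, h2]
    · simp [h1, h2]
      simp [← h2, h1]
    · simp [h1, h2]
  rw [Finset.prod_congr rfl (fun i _ => h i), Finset.prod_mul_distrib]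
  simp

theorem pal_sum_aux {C : ℕ} (f : Fin C → ℝ) (a b : Fin C) :
    ∑ y : Fin C, f y * (zeroOneLoss y a - zeroOneLoss y b) = f b - f a := by
  have h : ∀ y : Fin C, f y * (zeroOneLoss y a - zeroOneLoss y b)
      = (if y = b then f y else 0) - (if y = a then f y else 0) := by
    intro y
    unfold zeroOneLoss
    split_ifs <;> ring
  rw [Finset.sum_congr rfl (fun y _ => h y), Finset.sum_sub_distrib]
  simp

/-- **Theorem 2 (PAL reformulation).** The multi-class probabilistic active learning
criterion of Kottke et al. with `m = 1` equals the density-weighted expected local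
gain in the xPAL form. -/
theorem pal_reformulation {C : ℕ} (hC : 1 ≤ C) (k : Fin C → ℝ)
    (hk : ∀ y : Fin C, 0 ≤ k y)
    (s : ℝ) (hs : s = ∑ y : Fin C, (k y + 1))
    (yhat : Fin C) (hyhat : IsUniqueMax k yhat)
    (yhatp : Fin C → Fin C)
    (hyhatp : ∀ yc : Fin C, IsUniqueMax (fun y => k y + eR yc y) (yhatp yc))
    (phat : ℝ) :
    phat * ((∑ yc : Fin C, (1 / (s * (s + 1))) *
        ∏ i : Fin C, ∏ j ∈ Finset.Icc 1 (eN yc i + eN (yhatp yc) i), (k i + (j : ℝ)))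
      - (k yhat + 1) / s)
    = - phat * ∑ yc : Fin C, ((k yc + 1) / s) *
        ∑ y : Fin C, ((k y + eR yc y + 1) / (s + 1)) *
          (zeroOneLoss y (yhatp yc) - zeroOneLoss y yhat) := by
  have hs0 : 0 < s := by
    rw [hs]
    exact Finset.sum_pos (fun y _ => by linarith [hk y]) ⟨yhat, Finset.mem_univ _⟩
  have key : ∑ yc : Fin C, (k yc + 1) * (k yhat + eR yc yhat + 1) = (k yhat + 1) * (s + 1) := by
    have h : ∀ yc : Fin C, (k yc + 1) * (k yhat + eR yc yhat + 1)
        = (k yc + 1) * (k yhat + 1) + (if yhat = yc then k yc + 1 else 0) := by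
      intro yc
      unfold eR eN
      split_ifs <;> push_cast <;> ring
    rw [Finset.sum_congr rfl (fun y _ => h y), Finset.sum_add_distrib, ← Finset.sum_mul, ← hs]
    simp
    ring
  have key2 : (k yhat + 1) / s
      = ∑ yc : Fin C, (1 / (s * (s + 1))) * ((k yc + 1) * (k yhat + eR yc yhat + 1)) := by
    rw [← Finset.mul_sum, key]
    field_simp
  rw [neg_mul, ← mul_neg, key2, ← Finset.sum_sub_distrib, ← Finset.sum_neg_distrib]
  congr 1
  refine Finset.sum_congr rfl (fun yc _ => ?_)
  rw [pal_prod_aux, pal_sum_aux (fun y => (k y + eR yc y + 1) / (s + 1))]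
  field_simp
  ring
end
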